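/- (Yoccoz's lower bound.) There exists a constant C ∈ ℝ such that for every irrational θ ∈ (0,1) with Φ(θ) < ∞ one has r(θ) > 0 and Φ(θ) + log r(θ) ≥ C. -/

import Mathlib

open Complex Real

/-- The quadratic polynomial `P_θ(z) = z² + e^{2πiθ} z`. -/
noncomputable def Ptheta (θ : ℝ) : ℂ → ℂ :=
  fun z => z ^ 2 + Complex.exp (2 * Real.pi * Complex.I * θ) * z

/-- The sequence `θ₁ = θ`, `θ_{n+1} = {1/θ_n}` (indexed from `0`). -/
noncomputable def brjunoSeq (θ : ℝ) : ℕ → ℝ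
  | 0 => θ
  | n + 1 => Int.fract (1 / brjunoSeq θ n)

/-- The terms of the Brjuno series: `θ₁θ₂⋯θ_{n-1} log(1/θ_n)`. -/
noncomputable def brjunoTerm (θ : ℝ) (n : ℕ) : ℝ :=
  (∏ k ∈ Finset.range n, brjunoSeq θ k) * Real.log (1 / brjunoSeq θ n)

/-- The Brjuno function `Φ(θ)` (as a real number when the series converges). -/
noncomputable def brjunoFunction (θ : ℝ) : ℝ := ∑' n, brjunoTerm θ n

/-- The conformal radius of the Siegel disk of `P_θ` at `0`. -/
noncomputable def siegelRadius (θ : ℝ) : ℝ :=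
  sSup {ρ : ℝ | 0 < ρ ∧ ∃ φ : ℂ → ℂ,
    Set.InjOn φ (Metric.ball (0 : ℂ) ρ) ∧
    DifferentiableOn ℂ φ (Metric.ball (0 : ℂ) ρ) ∧
    φ 0 = 0 ∧ deriv φ 0 = 1 ∧
    ∀ z ∈ Metric.ball (0 : ℂ) ρ,
      Ptheta θ (φ z) = φ (Complex.exp (2 * Real.pi * Complex.I * θ) * z)}

/-- The sum over the internal nodes `v` of a binary tree of `f m`, where `m` is the number of
internal nodes of the subtree rooted at `v`. -/
noncomputable def nodeSum (f : ℕ → ℝ) : BinaryTree Unit → ℝ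
  | .nil => 0
  | .node _ l r => nodeSum f l + nodeSum f r + f (l.numNodes + r.numNodes + 1)

lemma nodeSum_sum {ι : Type*} (s : Finset ι) (w : ι → ℝ) (f : ι → ℕ → ℝ) (T : BinaryTree Unit) :
    nodeSum (fun m => ∑ k ∈ s, w k * f k m) T = ∑ k ∈ s, w k * nodeSum (f k) T := by
  induction T with
  | nil => simp [nodeSum]
  | node _ l r hl hr =>
    simp only [nodeSum, hl, hr, ← Finset.sum_add_distrib, mul_add]

lemma nodeSum_le_nodeSum {f g : ℕ → ℝ} (T : BinaryTree Unit)
    (h : ∀ m, 1 ≤ m → m ≤ T.numNodes → f m ≤ g m) : nodeSum f T ≤ nodeSum g T := by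
  induction T with
  | nil => simp [nodeSum]
  | node _ l r hl hr =>
    simp only [nodeSum]
    simp only [BinaryTree.numNodes] at h
    have h₁ := hl fun m h1 h2 => h m h1 (by lia)
    have h₂ := hr fun m h1 h2 => h m h1 (by lia)
    have h₃ := h (l.numNodes + r.numNodes + 1) (by lia) le_rfl
    linarith

/-- Suppose that any two elements of `A` closer than `E` are congruent modulo `q`, and that the
elements of `A` less than `E` are multiples of `q`. Among the maximal subtrees of a tree with size
in `A`, let the small ones have total size `s` and the `c` large ones total size `b`. These numbers
control how many nodes have size in `A`. -/
lemma exists_nodeSum_indicator_le {A : Set ℕ} {q : ℕ} {E : ℝ} (hq : 0 < q) (hE : 0 < E)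
    (hA : ∀ m ∈ A, (m : ℝ) < E → q ∣ m)
    (hAA : ∀ m ∈ A, ∀ n ∈ A, m ≤ n → (n : ℝ) - m < E → q ∣ n - m) (T : BinaryTree Unit) :
    ∃ s b c : ℕ, q ∣ s ∧ c * E ≤ b ∧ (c = 0 → b = 0) ∧ (c = 1 → b ∈ A) ∧ s + b ≤ T.numNodes ∧
      nodeSum (A.indicator 1) T ≤ s / q + (1 / q + 2 / E) * b - c := by
  have hq' : (0 : ℝ) < q := by exact_mod_cast hq
  induction T with
  | nil => exact ⟨0, 0, 0, by simp [nodeSum]⟩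
  | node _ l r hl hr =>
    obtain ⟨s₁, b₁, c₁, hs₁, hE₁, hz₁, ho₁, hn₁, hN₁⟩ := hl
    obtain ⟨s₂, b₂, c₂, hs₂, hE₂, hz₂, ho₂, hn₂, hN₂⟩ := hr
    have hs : q ∣ s₁ + s₂ := dvd_add hs₁ hs₂
    have hcE : ((c₁ + c₂ : ℕ) : ℝ) * E ≤ (b₁ + b₂ : ℕ) := by push_cast; linarith
    have hz : c₁ + c₂ = 0 → b₁ + b₂ = 0 := by lia
    have ho : c₁ + c₂ = 1 → b₁ + b₂ ∈ A := by
      intro h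
      rcases (by lia : c₁ = 0 ∧ c₂ = 1 ∨ c₁ = 1 ∧ c₂ = 0) with ⟨h0, h1⟩ | ⟨h1, h0⟩
      · simpa [hz₁ h0] using ho₂ h1
      · simpa [hz₂ h0] using ho₁ h1
    have hN : nodeSum (A.indicator 1) l + nodeSum (A.indicator 1) r ≤
        (s₁ + s₂ : ℕ) / q + (1 / q + 2 / E) * (b₁ + b₂ : ℕ) - (c₁ + c₂ : ℕ) := by
      push_cast
      rw [add_div]
      linarith
    have hn : s₁ + s₂ + (b₁ + b₂) ≤ l.numNodes + r.numNodes := by lia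
    generalize s₁ + s₂ = s at *
    generalize b₁ + b₂ = b at *
    generalize c₁ + c₂ = c at *
    simp only [BinaryTree.numNodes, nodeSum]
    generalize l.numNodes + r.numNodes = n at *
    by_cases hnA : n + 1 ∈ A
    · rw [Set.indicator_of_mem hnA]
      simp only [Pi.one_apply]
      rcases lt_or_ge ((n + 1 : ℕ) : ℝ) E with hlt | hge
      · have hc : c = 0 := by
          by_contra hc
          have h1 : (1 : ℝ) ≤ c := by exact_mod_cast Nat.one_le_iff_ne_zero.2 hc
          have h2 : (b : ℝ) ≤ (n + 1 : ℕ) := by exact_mod_cast (by lia : b ≤ n + 1)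
          nlinarith
        have hb := hz hc
        subst hc hb
        have hd := hA _ hnA hlt
        refine ⟨n + 1, 0, 0, hd, by simp, by simp, by simp, by simp, ?_⟩
        have h3 : s + q ≤ n + 1 := by
          obtain ⟨x, rfl⟩ := hs
          obtain ⟨y, hy⟩ := hd
          rw [hy]
          have : x < y := by
            by_contra h
            have := Nat.mul_le_mul_left q (not_lt.1 h)
            lia
          nlinarith
        have h4 : ((s : ℝ) + q) / q ≤ (n + 1 : ℕ) / q := by
          gcongr
          exact_mod_cast h3
        rw [add_div, div_self hq'.ne'] at h4
        simp only [Nat.cast_zero, mul_zero, add_zero, sub_zero] at hN ⊢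
        linarith
      · refine ⟨0, n + 1, 1, by simp, by simpa using hge, by simp, by simpa using hnA, by simp, ?_⟩
        have hηn : 2 ≤ 2 / E * (n + 1 : ℕ) := by
          rw [div_mul_eq_mul_div, le_div_iff₀ hE]
          linarith
        have hqd (x : ℝ) : x / q = 1 / q * x := by ring
        have hq1 : 0 < 1 / (q : ℝ) := by positivity
        have hE1 : 0 < 2 / E := by positivity
        have hqq : 1 / (q : ℝ) * q = 1 := by field_simp
        have hsb : (s : ℝ) + b ≤ (n + 1 : ℕ) := by exact_mod_cast (by lia : s + b ≤ n + 1)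
        rw [hqd] at hN
        simp only [Nat.cast_zero, zero_div, zero_add, Nat.cast_one]
        have hs0 : (0 : ℝ) ≤ s := by positivity
        generalize 1 / (q : ℝ) = u at *
        rcases (by lia : c = 0 ∨ c = 1 ∨ 2 ≤ c) with hc | hc | hc
        · have hb := hz hc
          subst hc hb
          simp only [Nat.cast_zero] at *
          nlinarith
        · have hbA := ho hc
          have hle : b ≤ n + 1 := by lia
          subst hc
          simp only [Nat.cast_one] at *
          rcases lt_or_ge (((n + 1 : ℕ) : ℝ) - b) E with hlt | hge'
          · have h3 : s + q ≤ n + 1 - b := by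
              obtain ⟨x, rfl⟩ := hs
              obtain ⟨y, hy⟩ := hAA _ hbA _ hnA hle hlt
              rw [hy]
              have : x < y := by
                by_contra h
                have := Nat.mul_le_mul_left q (not_lt.1 h)
                lia
              nlinarith
            have h4 : (s : ℝ) + q + b ≤ (n + 1 : ℕ) := by
              exact_mod_cast (by lia : s + q + b ≤ n + 1)
            have h5 : (b : ℝ) ≤ (n + 1 : ℕ) := by exact_mod_cast hle
            nlinarith [mul_le_mul_of_nonneg_left h4 hq1.le, mul_le_mul_of_nonneg_left h5 hE1.le]
          · have h6 : 2 ≤ 2 / E * ((n + 1 : ℕ) - b) := by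
              rw [div_mul_eq_mul_div, le_div_iff₀ hE]
              linarith
            nlinarith [mul_le_mul_of_nonneg_left hsb hq1.le]
        · have hc' : (2 : ℝ) ≤ c := by exact_mod_cast hc
          have h5 : (b : ℝ) ≤ (n + 1 : ℕ) := by linarith
          nlinarith [mul_le_mul_of_nonneg_left hsb hq1.le, mul_le_mul_of_nonneg_left h5 hE1.le]
    · rw [Set.indicator_of_notMem hnA, add_zero]
      exact ⟨s, b, c, hs, hcE, hz, ho, by lia, hN⟩

/-- The counting lemma of Davie type: a sharp bound for the number of small divisors of a given
scale in a tree. -/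
lemma nodeSum_indicator_le {A : Set ℕ} {q : ℕ} {E : ℝ} (hq : 0 < q) (hE : 0 < E)
    (hA : ∀ m ∈ A, (m : ℝ) < E → q ∣ m)
    (hAA : ∀ m ∈ A, ∀ n ∈ A, m ≤ n → (n : ℝ) - m < E → q ∣ n - m) (T : BinaryTree Unit) :
    nodeSum (A.indicator 1) T ≤ (1 / q + 2 / E) * T.numNodes := by
  obtain ⟨s, b, c, -, -, -, -, hn, hN⟩ := exists_nodeSum_indicator_le hq hE hA hAA T
  have h1 : (s : ℝ) + b ≤ T.numNodes := by exact_mod_cast hn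
  have h2 : 0 < 1 / (q : ℝ) := by positivity
  have h3 : 0 < 2 / E := by positivity
  have h4 : (0 : ℝ) ≤ c := by positivity
  have h5 : (0 : ℝ) ≤ s := by positivity
  rw [div_eq_mul_one_div] at hN
  nlinarith [mul_le_mul_of_nonneg_left h1 h2.le, mul_le_mul_of_nonneg_left h1 h3.le,
    mul_nonneg h3.le h5]

/-- A sequence satisfying the quadratic majorant recursion is bounded by Catalan numbers times the
maximal product of small divisors along a tree. -/
lemma exists_tree_le_catalan_mul {c f : ℕ → ℝ} (hc : ∀ m, 0 ≤ c m) (h0 : c 0 ≤ 1)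
    (hrec : ∀ m, c (m + 1) ≤
      Real.exp (f (m + 1)) * ∑ ij ∈ Finset.HasAntidiagonal.antidiagonal m, c ij.1 * c ij.2) (m : ℕ) :
    ∃ T : BinaryTree Unit, T.numNodes = m ∧ c m ≤ catalan m * Real.exp (nodeSum f T) := by
  induction m using Nat.strong_induction_on with
  | _ m ih =>
    cases m with
    | zero => exact ⟨.nil, rfl, by simpa [nodeSum] using h0⟩
    | succ m =>
      choose! T hT hcT using ih
      obtain ⟨x, hx, hmax⟩ := Finset.exists_max_image (Finset.HasAntidiagonal.antidiagonal m)
        (fun ij => nodeSum f (T ij.1) + nodeSum f (T ij.2)) ⟨(0, m), by simp⟩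
      have hlt (ij : ℕ × ℕ) (h : ij ∈ Finset.HasAntidiagonal.antidiagonal m) : ij.1 < m + 1 ∧ ij.2 < m + 1 := by
        have := Finset.HasAntidiagonal.mem_antidiagonal.1 h
        lia
      have hxm : x.1 + x.2 = m := Finset.HasAntidiagonal.mem_antidiagonal.1 hx
      have hnum : (T x.1).numNodes + (T x.2).numNodes = m := by
        rw [hT _ (hlt x hx).1, hT _ (hlt x hx).2, hxm]
      refine ⟨.node () (T x.1) (T x.2), by simp [hnum], (hrec m).trans ?_⟩
      rw [nodeSum, hnum, Real.exp_add _ (f (m + 1)), catalan_succ']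
      push_cast
      rw [mul_comm (Real.exp (f (m + 1))), ← mul_assoc]
      refine mul_le_mul_of_nonneg_right ?_ (Real.exp_nonneg _)
      rw [Finset.sum_mul]
      refine Finset.sum_le_sum fun ij hij => ?_
      calc c ij.1 * c ij.2
          ≤ (catalan ij.1 * Real.exp (nodeSum f (T ij.1))) *
            (catalan ij.2 * Real.exp (nodeSum f (T ij.2))) :=
            mul_le_mul (hcT _ (hlt ij hij).1) (hcT _ (hlt ij hij).2) (hc _) (by positivity)
        _ = catalan ij.1 * catalan ij.2 *
            Real.exp (nodeSum f (T ij.1) + nodeSum f (T ij.2)) := by rw [Real.exp_add]; ring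
        _ ≤ _ := by
          exact mul_le_mul_of_nonneg_left (Real.exp_le_exp.2 (hmax ij hij)) (by positivity)

lemma catalan_le_four_pow (n : ℕ) : catalan n ≤ 4 ^ n := by
  rw [catalan_eq_centralBinom_div]
  exact (Nat.div_le_self _ _).trans (Nat.centralBinom_le_four_pow n)

/-- The product `θ₁ ⋯ θ_n` of the first `n` terms of the Gauss map orbit. -/
noncomputable def brjunoProd (θ : ℝ) (n : ℕ) : ℝ := ∏ k ∈ Finset.range n, brjunoSeq θ k

/-- Denominators of the convergents. -/
noncomputable def convDen (θ : ℝ) : ℕ → ℕ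
  | 0 => 1
  | 1 => ⌊1 / θ⌋₊
  | n + 2 => ⌊1 / brjunoSeq θ (n + 1)⌋₊ * convDen θ (n + 1) + convDen θ n

/-- Numerators of the convergents. -/
noncomputable def convNum (θ : ℝ) : ℕ → ℕ
  | 0 => 0
  | 1 => 1
  | n + 2 => ⌊1 / brjunoSeq θ (n + 1)⌋₊ * convNum θ (n + 1) + convNum θ n

section ContinuedFraction

variable {θ : ℝ}

lemma brjunoProd_zero : brjunoProd θ 0 = 1 := by simp [brjunoProd]

lemma brjunoProd_succ (n : ℕ) : brjunoProd θ (n + 1) = brjunoProd θ n * brjunoSeq θ n := by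
  simp [brjunoProd, Finset.prod_range_succ]

lemma brjunoSeq_mem_Ioo (hθ : θ ∈ Set.Ioo (0 : ℝ) 1) (hirr : Irrational θ) (n : ℕ) :
    Irrational (brjunoSeq θ n) ∧ brjunoSeq θ n ∈ Set.Ioo (0 : ℝ) 1 := by
  induction n with
  | zero => exact ⟨hirr, hθ⟩
  | succ n ih =>
    have h : Irrational (brjunoSeq θ (n + 1)) := by
      rw [brjunoSeq, ← Int.self_sub_floor, one_div]
      exact ih.1.inv.sub_intCast _
    exact ⟨h, lt_of_le_of_ne (Int.fract_nonneg _) h.ne_zero.symm, Int.fract_lt_one _⟩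

lemma one_le_floor_one_div {x : ℝ} (hx : x ∈ Set.Ioo (0 : ℝ) 1) : 1 ≤ ⌊1 / x⌋₊ :=
  Nat.le_floor (by simpa using (one_lt_inv₀ hx.1).2 hx.2 |>.le)

lemma brjunoSeq_succ (hθ : θ ∈ Set.Ioo (0 : ℝ) 1) (hirr : Irrational θ) (n : ℕ) :
    brjunoSeq θ (n + 1) = 1 / brjunoSeq θ n - ⌊1 / brjunoSeq θ n⌋₊ := by
  have h := (brjunoSeq_mem_Ioo hθ hirr n).2.1
  rw [brjunoSeq, ← Int.self_sub_floor, natCast_floor_eq_intCast_floor (by positivity)]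

lemma brjunoProd_pos (hθ : θ ∈ Set.Ioo (0 : ℝ) 1) (hirr : Irrational θ) (n : ℕ) :
    0 < brjunoProd θ n :=
  Finset.prod_pos fun k _ => (brjunoSeq_mem_Ioo hθ hirr k).2.1

lemma brjunoProd_succ_le (hθ : θ ∈ Set.Ioo (0 : ℝ) 1) (hirr : Irrational θ) (n : ℕ) :
    brjunoProd θ (n + 1) ≤ brjunoProd θ n := by
  rw [brjunoProd_succ]
  exact mul_le_of_le_one_right (brjunoProd_pos hθ hirr n).le (brjunoSeq_mem_Ioo hθ hirr n).2.2.le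

lemma brjunoProd_add_two (hθ : θ ∈ Set.Ioo (0 : ℝ) 1) (hirr : Irrational θ) (n : ℕ) :
    brjunoProd θ (n + 2) =
      brjunoProd θ n - ⌊1 / brjunoSeq θ n⌋₊ * brjunoProd θ (n + 1) := by
  have h := (brjunoSeq_mem_Ioo hθ hirr n).2.1.ne'
  rw [brjunoProd_succ (n + 1), brjunoSeq_succ hθ hirr, brjunoProd_succ n]
  field_simp

lemma convDen_pos (hθ : θ ∈ Set.Ioo (0 : ℝ) 1) (n : ℕ) : 0 < convDen θ n := by
  induction n using Nat.strong_induction_on with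
  | _ n ih =>
    match n with
    | 0 => simp [convDen]
    | 1 => exact one_le_floor_one_div hθ
    | n + 2 => exact Nat.add_pos_right _ (ih n (by lia))

lemma convDen_le_succ (hθ : θ ∈ Set.Ioo (0 : ℝ) 1) (hirr : Irrational θ) (n : ℕ) :
    convDen θ n ≤ convDen θ (n + 1) := by
  match n with
  | 0 => exact one_le_floor_one_div hθ
  | n + 1 =>
    exact (Nat.le_mul_of_pos_left _
      (one_le_floor_one_div (brjunoSeq_mem_Ioo hθ hirr (n + 1)).2)).trans (Nat.le_add_right _ _)

lemma convDen_mul_brjunoProd (hθ : θ ∈ Set.Ioo (0 : ℝ) 1) (hirr : Irrational θ) (n : ℕ) :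
    convDen θ (n + 1) * brjunoProd θ (n + 1) + convDen θ n * brjunoProd θ (n + 2) = 1 := by
  induction n with
  | zero =>
    rw [brjunoProd_add_two hθ hirr, brjunoProd_zero]
    simp [convDen, brjunoSeq]
  | succ n ih =>
    rw [brjunoProd_add_two hθ hirr (n + 1), convDen]
    push_cast
    linarith

lemma convDen_mul_sub_convNum (hθ : θ ∈ Set.Ioo (0 : ℝ) 1) (hirr : Irrational θ) (n : ℕ) :
    convDen θ n * θ - convNum θ n = (-1) ^ n * brjunoProd θ (n + 1) ∧
    convDen θ (n + 1) * θ - convNum θ (n + 1) = (-1) ^ (n + 1) * brjunoProd θ (n + 2) := by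
  induction n with
  | zero =>
    rw [brjunoProd_add_two hθ hirr, brjunoProd_succ, brjunoProd_zero]
    constructor
    · simp [convDen, convNum, brjunoSeq]
    · simp [convDen, convNum, brjunoSeq]
  | succ n ih =>
    refine ⟨ih.2, ?_⟩
    obtain ⟨h1, h2⟩ := ih
    rw [brjunoProd_add_two hθ hirr (n + 1), convDen, convNum]
    push_cast
    rw [pow_succ] at h2 ⊢
    rw [pow_succ]
    linear_combination h1 + (⌊1 / brjunoSeq θ (n + 1)⌋₊ : ℝ) * h2

lemma abs_convDen_mul_sub_convNum (hθ : θ ∈ Set.Ioo (0 : ℝ) 1) (hirr : Irrational θ) (n : ℕ) :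
    |convDen θ n * θ - convNum θ n| = brjunoProd θ (n + 1) := by
  rw [(convDen_mul_sub_convNum hθ hirr n).1, abs_mul, abs_pow, abs_neg, abs_one, one_pow, one_mul,
    abs_of_pos (brjunoProd_pos hθ hirr _)]

lemma convNum_mul_sub (n : ℕ) :
    (convNum θ (n + 1) * convDen θ n - convNum θ n * convDen θ (n + 1) : ℤ) = (-1) ^ n := by
  induction n with
  | zero => simp [convDen, convNum]
  | succ n ih =>
    rw [convDen, convNum, pow_succ, ← ih]
    push_cast
    ring

lemma isCoprime_convNum_convDen (n : ℕ) : IsCoprime (convDen θ n : ℤ) (convNum θ n) := by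
  refine ⟨(-1) ^ n * convNum θ (n + 1), -(-1) ^ n * convDen θ (n + 1), ?_⟩
  have h : ((-1) ^ n * (-1) ^ n : ℤ) = 1 := by rw [← mul_pow]; simp
  linear_combination (-1) ^ n * convNum_mul_sub (θ := θ) n + h

lemma one_div_convDen_le (hθ : θ ∈ Set.Ioo (0 : ℝ) 1) (hirr : Irrational θ) (n : ℕ) :
    1 / (convDen θ n : ℝ) ≤ brjunoProd θ n + brjunoProd θ (n + 1) := by
  have hpos := brjunoProd_pos hθ hirr
  match n with
  | 0 => simpa [convDen, brjunoProd_zero] using (hpos 1).le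
  | n + 1 =>
    have hq : (0 : ℝ) < convDen θ (n + 1) := by exact_mod_cast convDen_pos hθ _
    have hle : (convDen θ n : ℝ) ≤ convDen θ (n + 1) := by exact_mod_cast convDen_le_succ hθ hirr n
    rw [div_le_iff₀ hq, ← convDen_mul_brjunoProd hθ hirr n]
    nlinarith [hpos (n + 2)]

lemma convDen_mul_brjunoProd_le (hθ : θ ∈ Set.Ioo (0 : ℝ) 1) (hirr : Irrational θ) (n : ℕ) :
    convDen θ n * brjunoProd θ n ≤ 1 := by
  match n with
  | 0 => simp [convDen, brjunoProd_zero]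
  | n + 1 =>
    rw [← convDen_mul_brjunoProd hθ hirr n]
    have := brjunoProd_pos hθ hirr (n + 2)
    exact le_add_of_nonneg_right (by positivity)

lemma one_div_convDen_le_two_mul (hθ : θ ∈ Set.Ioo (0 : ℝ) 1) (hirr : Irrational θ) (n : ℕ) :
    1 / (convDen θ n : ℝ) ≤ 2 * brjunoProd θ n := by
  linarith [one_div_convDen_le hθ hirr n, brjunoProd_succ_le hθ hirr n]

lemma sum_brjunoProd_le (hθ : θ ∈ Set.Ioo (0 : ℝ) 1) (hirr : Irrational θ) (n : ℕ) :
    ∑ k ∈ Finset.range n, brjunoProd θ k ≤ 4 := by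
  have hpos := brjunoProd_pos hθ hirr
  suffices h : ∑ k ∈ Finset.range n, brjunoProd θ k + 2 * brjunoProd θ n +
      2 * brjunoProd θ (n + 1) ≤ 4 by linarith [hpos n, hpos (n + 1)]
  induction n with
  | zero =>
    rw [brjunoProd_succ, brjunoProd_zero]
    simp [brjunoSeq]
    linarith [hθ.2]
  | succ n ih =>
    rw [Finset.sum_range_succ]
    have h1 := brjunoProd_add_two hθ hirr n
    have h2 := brjunoProd_succ_le hθ hirr (n + 1)
    have h3 : (1 : ℝ) ≤ ⌊1 / brjunoSeq θ n⌋₊ := by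
      exact_mod_cast one_le_floor_one_div (brjunoSeq_mem_Ioo hθ hirr n).2
    nlinarith [hpos (n + 1)]

lemma tendsto_brjunoProd (hθ : θ ∈ Set.Ioo (0 : ℝ) 1) (hirr : Irrational θ) :
    Filter.Tendsto (brjunoProd θ) Filter.atTop (nhds 0) :=
  (summable_of_sum_range_le (fun n => (brjunoProd_pos hθ hirr n).le)
    (sum_brjunoProd_le hθ hirr)).tendsto_atTop_zero

lemma brjunoTerm_eq (n : ℕ) : brjunoTerm θ n = brjunoProd θ n * Real.log (1 / brjunoSeq θ n) := rfl

lemma log_one_div_brjunoSeq_nonneg (hθ : θ ∈ Set.Ioo (0 : ℝ) 1) (hirr : Irrational θ) (n : ℕ) :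
    0 ≤ Real.log (1 / brjunoSeq θ n) := by
  have h := (brjunoSeq_mem_Ioo hθ hirr n).2
  exact Real.log_nonneg (by simpa using (one_lt_inv₀ h.1).2 h.2 |>.le)

/-- The weighted sum of the logarithmic sizes of the partial quotients is bounded by the Brjuno
function up to a universal constant. -/
lemma sum_log_convDen_le (hθ : θ ∈ Set.Ioo (0 : ℝ) 1) (hirr : Irrational θ)
    (hs : Summable (brjunoTerm θ)) (K : ℕ) :
    ∑ k ∈ Finset.range K, Real.log (convDen θ (k + 1) / convDen θ k) *
      (1 / convDen θ k + 4 * brjunoProd θ (k + 1)) ≤ brjunoFunction θ + 44 := by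
  have hpos := brjunoProd_pos hθ hirr
  have hterm (k : ℕ) : Real.log (convDen θ (k + 1) / convDen θ k) *
      (1 / convDen θ k + 4 * brjunoProd θ (k + 1)) ≤ brjunoTerm θ k + 11 * brjunoProd θ k := by
    have hsk := (brjunoSeq_mem_Ioo hθ hirr k).2
    have hq0 : (0 : ℝ) < convDen θ k := by exact_mod_cast convDen_pos hθ k
    have hq1 : (0 : ℝ) < convDen θ (k + 1) := by exact_mod_cast convDen_pos hθ (k + 1)
    have hquot : (convDen θ (k + 1) / convDen θ k : ℝ) ≤ 2 * (1 / brjunoSeq θ k) := by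
      have h1 := convDen_mul_brjunoProd_le hθ hirr (k + 1)
      have h2 := one_div_convDen_le_two_mul hθ hirr k
      have h3 : (convDen θ (k + 1) : ℝ) ≤ 1 / brjunoProd θ (k + 1) := by
        rwa [le_div_iff₀ (hpos _)]
      calc (convDen θ (k + 1) / convDen θ k : ℝ)
          = convDen θ (k + 1) * (1 / convDen θ k) := by ring
        _ ≤ (1 / brjunoProd θ (k + 1)) * (2 * brjunoProd θ k) :=
          mul_le_mul h3 h2 (by positivity) (one_div_pos.2 (hpos _)).le
        _ = 2 * (1 / brjunoSeq θ k) := by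
          rw [brjunoProd_succ]
          have := (hpos k).ne'
          have := hsk.1.ne'
          field_simp
    have hl0 := log_one_div_brjunoSeq_nonneg hθ hirr k
    have hlog : Real.log (convDen θ (k + 1) / convDen θ k) ≤
        1 + Real.log (1 / brjunoSeq θ k) := by
      refine (Real.log_le_log (by positivity) hquot).trans ?_
      rw [Real.log_mul two_ne_zero (one_div_pos.2 hsk.1).ne']
      linarith [Real.log_two_lt_d9]
    have hcoef : 1 / (convDen θ k : ℝ) + 4 * brjunoProd θ (k + 1) ≤
        brjunoProd θ k + 5 * (brjunoProd θ k * brjunoSeq θ k) := by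
      rw [← brjunoProd_succ]
      linarith [one_div_convDen_le hθ hirr k]
    have hsl : brjunoSeq θ k * Real.log (1 / brjunoSeq θ k) ≤ 1 := by
      have h1 := Real.log_le_self (one_div_pos.2 hsk.1).le
      calc _ ≤ brjunoSeq θ k * (1 / brjunoSeq θ k) := mul_le_mul_of_nonneg_left h1 hsk.1.le
        _ = 1 := mul_one_div_cancel hsk.1.ne'
    rw [brjunoTerm_eq]
    set L := Real.log (1 / brjunoSeq θ k)
    set B := brjunoProd θ k
    set s := brjunoSeq θ k
    have hB : 0 < B := hpos k
    calc _ ≤ (1 + L) * (B + 5 * (B * s)) :=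
          mul_le_mul hlog hcoef (by have := hpos (k + 1); positivity) (by positivity)
      _ = B * L + B * (1 + 5 * s + 5 * (s * L)) := by ring
      _ ≤ B * L + B * 11 := by
        gcongr
        linarith [hsk.2]
      _ = _ := by ring
  calc _ ≤ ∑ k ∈ Finset.range K, (brjunoTerm θ k + 11 * brjunoProd θ k) :=
        Finset.sum_le_sum fun k _ => hterm k
    _ = ∑ k ∈ Finset.range K, brjunoTerm θ k + 11 * ∑ k ∈ Finset.range K, brjunoProd θ k := by
        rw [Finset.sum_add_distrib, Finset.mul_sum]
    _ ≤ brjunoFunction θ + 11 * 4 := by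
        gcongr
        · exact hs.sum_le_tsum _ fun k _ => mul_nonneg (hpos k).le
            (log_one_div_brjunoSeq_nonneg hθ hirr k)
        · exact sum_brjunoProd_le hθ hirr K
    _ = _ := by ring

/-- Integers `d` with `d θ` close to an integer are multiples of the denominator of the convergent,
unless they are very large. -/
lemma convDen_dvd (hθ : θ ∈ Set.Ioo (0 : ℝ) 1) (hirr : Irrational θ) (k : ℕ) {d : ℕ} {j : ℤ}
    (hd : (d : ℝ) < 1 / (2 * brjunoProd θ (k + 1))) (hj : |d * θ - j| < 1 / (2 * convDen θ k)) :
    convDen θ k ∣ d := by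
  have hβ := brjunoProd_pos hθ hirr (k + 1)
  have hq : (0 : ℝ) < convDen θ k := by exact_mod_cast convDen_pos hθ k
  have h0 := abs_convDen_mul_sub_convNum hθ hirr k
  have h1 : d * brjunoProd θ (k + 1) < 1 / 2 := by
    rw [lt_div_iff₀ (by positivity)] at hd
    linarith
  have h2 : convDen θ k * |d * θ - j| < 1 / 2 := by
    rw [lt_div_iff₀ (by positivity)] at hj
    linarith
  have h3 : |((d * convNum θ k - convDen θ k * j : ℤ) : ℝ)| < 1 := by
    calc |((d * convNum θ k - convDen θ k * j : ℤ) : ℝ)|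
        = |convDen θ k * (d * θ - j) - d * (convDen θ k * θ - convNum θ k)| := by
          push_cast
          ring_nf
      _ ≤ |convDen θ k * (d * θ - j)| + |d * (convDen θ k * θ - convNum θ k)| := abs_sub _ _
      _ < 1 := by
          rw [abs_mul, abs_mul, h0, Nat.abs_cast, Nat.abs_cast]
          linarith
  have h4 : (d * convNum θ k - convDen θ k * j : ℤ) = 0 := by
    rw [← Int.abs_lt_one_iff]
    exact_mod_cast h3
  have h5 : (convDen θ k : ℤ) ∣ d * convNum θ k := ⟨j, by linarith⟩
  exact_mod_cast (isCoprime_convNum_convDen k).dvd_of_dvd_mul_right h5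

end ContinuedFraction

lemma four_mul_abs_sub_round_le (x : ℝ) :
    4 * |x - round x| ≤ ‖Complex.exp (2 * π * Complex.I * x) - 1‖ := by
  have h1 : Complex.exp (2 * π * Complex.I * x) =
      Complex.exp (Complex.I * (2 * π * (x - round x) : ℝ)) := by
    rw [Complex.exp_eq_exp_iff_exists_int]
    refine ⟨round x, ?_⟩
    push_cast
    ring
  have h2 : |π * (x - round x)| = π * |x - round x| := by
    rw [abs_mul, abs_of_pos Real.pi_pos]
  have h3 : |π * (x - round x)| ≤ π / 2 := by
    rw [h2]
    nlinarith [abs_sub_round x, Real.pi_pos]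
  have h4 := Real.mul_abs_le_abs_sin h3
  rw [h1, Complex.norm_exp_I_mul_ofReal_sub_one, Real.norm_eq_abs, abs_mul, abs_two,
    show 2 * π * (x - round x) / 2 = π * (x - round x) by ring]
  rw [h2] at h4
  calc 4 * |x - round x| = 2 * (2 / π * (π * |x - round x|)) := by
        field_simp
        ring
    _ ≤ _ := by gcongr

/-- The logarithmic size `log (1 / |λ ^ m - 1|)` of the `m`-th small divisor, `λ = e^{2πiθ}`. -/
noncomputable def smallDivisor (θ : ℝ) (m : ℕ) : ℝ :=
  -Real.log ‖Complex.exp (2 * π * Complex.I * θ) ^ m - 1‖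

/-- The integers `m` for which `m θ` is close to an integer, at the scale of the `k`-th
convergent. -/
def nearReturns (θ : ℝ) (k : ℕ) : Set ℕ :=
  {m | |m * θ - round (m * θ)| < 1 / (4 * convDen θ k)}

section SmallDivisors

variable {θ : ℝ}

lemma abs_sub_round_pos (hirr : Irrational θ) {m : ℕ} (hm : 1 ≤ m) :
    0 < |m * θ - round (m * θ)| := by
  rw [abs_pos, sub_ne_zero]
  exact (hirr.natCast_mul (by lia)).ne_int _

lemma four_mul_abs_sub_round_le_norm_pow (m : ℕ) :
    4 * |m * θ - round (m * θ)| ≤ ‖Complex.exp (2 * π * Complex.I * θ) ^ m - 1‖ := by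
  rw [← Complex.exp_nat_mul]
  convert four_mul_abs_sub_round_le (m * θ) using 4
  push_cast
  ring

lemma min_le_sum_log_convDen (hθ : θ ∈ Set.Ioo (0 : ℝ) 1) (hirr : Irrational θ) {m : ℕ}
    (hm : 1 ≤ m) (K : ℕ) :
    min (Real.log (convDen θ K)) (-Real.log (4 * |m * θ - round (m * θ)|)) ≤
      ∑ k ∈ Finset.range K, Real.log (convDen θ (k + 1) / convDen θ k) *
        (nearReturns θ k).indicator 1 m := by
  have hpos := abs_sub_round_pos hirr hm
  induction K with
  | zero => simp [convDen]
  | succ K ih =>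
    have hq0 : (0 : ℝ) < convDen θ K := by exact_mod_cast convDen_pos hθ K
    have hq1 : (0 : ℝ) < convDen θ (K + 1) := by exact_mod_cast convDen_pos hθ (K + 1)
    rw [Finset.sum_range_succ]
    by_cases hmem : m ∈ nearReturns θ K
    · rw [Set.indicator_of_mem hmem, Pi.one_apply, mul_one, Real.log_div hq1.ne' hq0.ne']
      have hlt : 4 * |m * θ - round (m * θ)| < (convDen θ K : ℝ)⁻¹ := by
        have h : |m * θ - round (m * θ)| < 1 / (4 * convDen θ K) := hmem
        rw [lt_div_iff₀ (by positivity)] at h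
        rw [lt_inv_comm₀ (by positivity) hq0, lt_inv_comm₀ hq0 (by positivity), ← one_div,
          lt_div_iff₀ hq0]
        linarith
      have h := Real.log_lt_log (by positivity) hlt
      rw [Real.log_inv] at h
      rw [min_eq_left (by linarith)] at ih
      exact (min_le_left _ _).trans (by linarith)
    · rw [Set.indicator_of_notMem hmem, mul_zero, add_zero]
      refine le_trans ?_ ih
      have hle : (convDen θ K : ℝ)⁻¹ ≤ 4 * |m * θ - round (m * θ)| := by
        have h : 1 / (4 * convDen θ K) ≤ |m * θ - round (m * θ)| := not_lt.1 hmem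
        rw [div_le_iff₀ (by positivity)] at h
        rw [← one_div, div_le_iff₀ hq0]
        linarith
      have h := Real.log_le_log (by positivity) hle
      rw [Real.log_inv] at h
      exact (min_le_right _ _).trans (le_min (by linarith) le_rfl)

lemma nodeSum_nearReturns_le (hθ : θ ∈ Set.Ioo (0 : ℝ) 1) (hirr : Irrational θ) (k : ℕ)
    (T : BinaryTree Unit) : nodeSum ((nearReturns θ k).indicator 1) T ≤
      (1 / convDen θ k + 4 * brjunoProd θ (k + 1)) * T.numNodes := by
  have hβ := brjunoProd_pos hθ hirr (k + 1)
  have hq : (0 : ℝ) < convDen θ k := by exact_mod_cast convDen_pos hθ k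
  have hhalf : 1 / (4 * convDen θ k : ℝ) + 1 / (4 * convDen θ k) = 1 / (2 * convDen θ k) := by
    field_simp
    norm_num
  have hquarter : 0 < 1 / (4 * convDen θ k : ℝ) := by positivity
  have h := nodeSum_indicator_le (A := nearReturns θ k) (convDen_pos hθ k)
    (E := 1 / (2 * brjunoProd θ (k + 1))) (by positivity) ?_ ?_ T
  · convert h using 3
    field_simp
    norm_num
  · intro m hm hlt
    have hm' : |m * θ - round (m * θ)| < 1 / (4 * convDen θ k) := hm
    exact convDen_dvd hθ hirr k hlt (hm'.trans (by linarith))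
  · intro m hm n hn hmn hlt
    have hm' : |m * θ - round (m * θ)| < 1 / (4 * convDen θ k) := hm
    have hn' : |n * θ - round (n * θ)| < 1 / (4 * convDen θ k) := hn
    refine convDen_dvd hθ hirr k (j := round (n * θ) - round (m * θ)) ?_ ?_
    · rwa [Nat.cast_sub hmn]
    · rw [← hhalf, Nat.cast_sub hmn]
      push_cast
      calc |((n : ℝ) - m) * θ - (round (n * θ) - round (m * θ))|
          = |(n * θ - round (n * θ)) - (m * θ - round (m * θ))| := by ring_nf
        _ ≤ |n * θ - round (n * θ)| + |m * θ - round (m * θ)| := abs_sub _ _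
        _ < _ := add_lt_add hn' hm'

lemma nodeSum_smallDivisor_le (hθ : θ ∈ Set.Ioo (0 : ℝ) 1) (hirr : Irrational θ)
    (hs : Summable (brjunoTerm θ)) (T : BinaryTree Unit) :
    nodeSum (smallDivisor θ) T ≤ (brjunoFunction θ + 44) * T.numNodes := by
  have hev (m : ℕ) (hm : 1 ≤ m) : ∀ᶠ K in Filter.atTop,
      2 * brjunoProd θ K < 4 * |m * θ - round (m * θ)| := by
    have h := (tendsto_brjunoProd hθ hirr).const_mul 2
    rw [mul_zero] at h
    exact h.eventually_lt_const (by have := abs_sub_round_pos hirr hm; positivity)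
  obtain ⟨K, hK⟩ := ((Filter.eventually_all_finset (Finset.Icc 1 T.numNodes)).2 fun m hm =>
    hev m (Finset.mem_Icc.1 hm).1).exists
  have hle : nodeSum (smallDivisor θ) T ≤ nodeSum (fun m => ∑ k ∈ Finset.range K,
      Real.log (convDen θ (k + 1) / convDen θ k) * (nearReturns θ k).indicator 1 m) T := by
    refine nodeSum_le_nodeSum T fun m h1 h2 => ?_
    have hpos := abs_sub_round_pos hirr h1
    have hlog : -Real.log (4 * |m * θ - round (m * θ)|) ≤ Real.log (convDen θ K) := by
      have h3 := (one_div_convDen_le_two_mul hθ hirr K).trans_lt (hK m (Finset.mem_Icc.2 ⟨h1, h2⟩))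
      have hq : (0 : ℝ) < convDen θ K := by exact_mod_cast convDen_pos hθ K
      have h4 := Real.log_le_log (by positivity) h3.le
      rw [one_div, Real.log_inv] at h4
      linarith
    have h5 := min_le_sum_log_convDen hθ hirr h1 K
    rw [min_eq_right hlog] at h5
    refine le_trans ?_ h5
    exact neg_le_neg (Real.log_le_log (by positivity) (four_mul_abs_sub_round_le_norm_pow m))
  refine hle.trans ?_
  rw [nodeSum_sum]
  calc _ ≤ ∑ k ∈ Finset.range K, Real.log (convDen θ (k + 1) / convDen θ k) *
        ((1 / convDen θ k + 4 * brjunoProd θ (k + 1)) * T.numNodes) := by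
        refine Finset.sum_le_sum fun k _ =>
          mul_le_mul_of_nonneg_left (nodeSum_nearReturns_le hθ hirr k T) (Real.log_nonneg ?_)
        have hq : (0 : ℝ) < convDen θ k := by exact_mod_cast convDen_pos hθ k
        rw [one_le_div hq]
        exact_mod_cast convDen_le_succ hθ hirr k
    _ = (∑ k ∈ Finset.range K, Real.log (convDen θ (k + 1) / convDen θ k) *
        (1 / convDen θ k + 4 * brjunoProd θ (k + 1))) * T.numNodes := by
        rw [Finset.sum_mul]
        exact Finset.sum_congr rfl fun k _ => by ring
    _ ≤ _ := by
        gcongr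
        exact sum_log_convDen_le hθ hirr hs K

end SmallDivisors

/-- The coefficients of the formal linearization `z ∑ c_m z ^ m` of `z ^ 2 + l z`. -/
noncomputable def linCoeff (l : ℂ) : ℕ → ℂ
  | 0 => 1
  | m + 1 => (∑ i : Fin (m + 1), linCoeff l i * linCoeff l (m - i)) / (l ^ (m + 2) - l)

lemma linCoeff_zero (l : ℂ) : linCoeff l 0 = 1 := by rw [linCoeff]

lemma linCoeff_succ (l : ℂ) (m : ℕ) : linCoeff l (m + 1) =
    (∑ ij ∈ Finset.HasAntidiagonal.antidiagonal m, linCoeff l ij.1 * linCoeff l ij.2) /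
      (l ^ (m + 2) - l) := by
  rw [linCoeff, Finset.Nat.sum_antidiagonal_eq_sum_range_succ
    (fun x y => linCoeff l x * linCoeff l y) m, Finset.sum_range]

lemma norm_exp_two_pi_I_mul (θ : ℝ) : ‖Complex.exp (2 * π * Complex.I * θ)‖ = 1 := by
  rw [show (2 * π * Complex.I * θ : ℂ) = (2 * π * θ : ℝ) * Complex.I by push_cast; ring]
  exact Complex.norm_exp_ofReal_mul_I _

lemma norm_linCoeff_le {θ : ℝ} (hθ : θ ∈ Set.Ioo (0 : ℝ) 1) (hirr : Irrational θ)
    (hs : Summable (brjunoTerm θ)) (m : ℕ) :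
    ‖linCoeff (Complex.exp (2 * π * Complex.I * θ)) m‖ ≤
      (4 * Real.exp (brjunoFunction θ + 44)) ^ m := by
  set l := Complex.exp (2 * π * Complex.I * θ) with hl
  have hl1 : ‖l‖ = 1 := norm_exp_two_pi_I_mul θ
  obtain ⟨T, hT, hle⟩ := exists_tree_le_catalan_mul (c := fun m => ‖linCoeff l m‖)
    (f := smallDivisor θ) (fun m => norm_nonneg _) (by simp [linCoeff_zero]) (fun m => by
      have hpos : 0 < ‖l ^ (m + 1) - 1‖ := by
        refine lt_of_lt_of_le ?_ (four_mul_abs_sub_round_le_norm_pow (m + 1))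
        have := abs_sub_round_pos hirr (m := m + 1) (by lia)
        positivity
      have hnorm : ‖l ^ (m + 2) - l‖ = ‖l ^ (m + 1) - 1‖ := by
        rw [show l ^ (m + 2) - l = l * (l ^ (m + 1) - 1) by ring, norm_mul, hl1, one_mul]
      rw [linCoeff_succ, norm_div, hnorm, smallDivisor, ← hl, Real.exp_neg, Real.exp_log hpos,
        div_eq_inv_mul]
      gcongr
      refine (norm_sum_le _ _).trans (Finset.sum_le_sum fun ij _ => (norm_mul _ _).le)) m
  refine hle.trans ?_
  rw [mul_pow, ← Real.exp_nat_mul]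
  gcongr
  · exact_mod_cast catalan_le_four_pow m
  · rw [mul_comm, ← hT]
    exact nodeSum_smallDivisor_le hθ hirr hs T

lemma norm_pow_succ_sub_pow_succ_le {z w : ℂ} {r : ℝ} (hz : ‖z‖ ≤ r) (hw : ‖w‖ ≤ r) (n : ℕ) :
    ‖z ^ (n + 1) - w ^ (n + 1)‖ ≤ (n + 1) * r ^ n * ‖z - w‖ := by
  induction n with
  | zero => simp
  | succ n ih =>
    have hr : 0 ≤ r := (norm_nonneg z).trans hz
    calc ‖z ^ (n + 1 + 1) - w ^ (n + 1 + 1)‖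
        = ‖z * (z ^ (n + 1) - w ^ (n + 1)) + w ^ (n + 1) * (z - w)‖ := by ring_nf
      _ ≤ ‖z‖ * ‖z ^ (n + 1) - w ^ (n + 1)‖ + ‖w‖ ^ (n + 1) * ‖z - w‖ := by
        refine (norm_add_le _ _).trans ?_
        rw [norm_mul, norm_mul, norm_pow]
      _ ≤ r * ((n + 1) * r ^ n * ‖z - w‖) + r ^ (n + 1) * ‖z - w‖ := by gcongr
      _ = _ := by push_cast; ring

section Linearization

variable {l : ℂ} {M : ℝ}

lemma norm_linCoeff_mul_pow_le (hM : 0 < M) (hc : ∀ m, ‖linCoeff l m‖ ≤ M ^ m) {z : ℂ}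
    (hz : ‖z‖ ≤ 1 / (8 * M)) (m : ℕ) : ‖linCoeff l m * z ^ m‖ ≤ (1 / 8) ^ m := by
  rw [norm_mul, norm_pow]
  calc ‖linCoeff l m‖ * ‖z‖ ^ m ≤ M ^ m * (1 / (8 * M)) ^ m := by
        gcongr
        exact hc m
    _ = (1 / 8) ^ m := by
        rw [← mul_pow]
        congr 1
        field_simp

lemma summable_norm_linCoeff (hM : 0 < M) (hc : ∀ m, ‖linCoeff l m‖ ≤ M ^ m) {z : ℂ}
    (hz : ‖z‖ ≤ 1 / (8 * M)) : Summable fun m => ‖linCoeff l m * z ^ m‖ :=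
  Summable.of_nonneg_of_le (fun _ => norm_nonneg _) (norm_linCoeff_mul_pow_le hM hc hz)
    (summable_geometric_of_lt_one (by norm_num) (by norm_num))

lemma linearization_equation (hl1 : ‖l‖ = 1) (hl : ∀ m, l ^ (m + 2) - l ≠ 0) (hM : 0 < M)
    (hc : ∀ m, ‖linCoeff l m‖ ≤ M ^ m) {z : ℂ} (hz : ‖z‖ ≤ 1 / (8 * M)) :
    (z * ∑' m, linCoeff l m * z ^ m) ^ 2 + l * (z * ∑' m, linCoeff l m * z ^ m) =
      l * z * ∑' m, linCoeff l m * (l * z) ^ m := by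
  have hs := summable_norm_linCoeff hM hc hz
  have hlz : ‖l * z‖ ≤ 1 / (8 * M) := by rwa [norm_mul, hl1, one_mul]
  have hs' := summable_norm_linCoeff hM hc hlz
  have hsq : (∑' m, linCoeff l m * z ^ m) * (∑' m, linCoeff l m * z ^ m) =
      ∑' m, (l ^ (m + 2) - l) * linCoeff l (m + 1) * z ^ m := by
    rw [tsum_mul_tsum_eq_tsum_sum_antidiagonal_of_summable_norm hs hs]
    refine tsum_congr fun m => ?_
    rw [linCoeff_succ, mul_div_cancel₀ _ (hl m), Finset.sum_mul]
    refine Finset.sum_congr rfl fun ij hij => ?_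
    rw [← Finset.HasAntidiagonal.mem_antidiagonal.1 hij, pow_add]
    ring
  have hdiff : l * ∑' m, linCoeff l m * (l * z) ^ m - l * ∑' m, linCoeff l m * z ^ m =
      z * ∑' m, (l ^ (m + 2) - l) * linCoeff l (m + 1) * z ^ m := by
    rw [← mul_sub, ← hs'.of_norm.tsum_sub hs.of_norm, (hs'.of_norm.sub hs.of_norm).tsum_eq_zero_add]
    simp only [pow_zero, mul_one, sub_self, zero_add]
    rw [← tsum_mul_left, ← tsum_mul_left]
    exact tsum_congr fun m => by ring
  linear_combination z ^ 2 * hsq - z * hdiff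

lemma differentiableOn_linCoeff_tsum (hM : 0 < M) (hc : ∀ m, ‖linCoeff l m‖ ≤ M ^ m) :
    DifferentiableOn ℂ (fun z => ∑' m, linCoeff l m * z ^ m) (Metric.ball 0 (1 / (8 * M))) := by
  refine Complex.differentiableOn_tsum_of_summable_norm
    (u := fun m : ℕ => (1 / 8 : ℝ) ^ m)
    (summable_geometric_of_lt_one (by norm_num) (by norm_num)) (fun m => by fun_prop)
    Metric.isOpen_ball fun m z hz => ?_
  exact norm_linCoeff_mul_pow_le hM hc (mem_ball_zero_iff.1 hz).le m

lemma injOn_linearization (hM : 0 < M) (hc : ∀ m, ‖linCoeff l m‖ ≤ M ^ m) :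
    Set.InjOn (fun z => z * ∑' m, linCoeff l m * z ^ m) (Metric.ball 0 (1 / (8 * M))) := by
  intro z hz w hw hzw
  have hz := (mem_ball_zero_iff.1 hz).le
  have hw := (mem_ball_zero_iff.1 hw).le
  have hsz := (summable_norm_linCoeff hM hc hz).of_norm.mul_left z
  have hsw := (summable_norm_linCoeff hM hc hw).of_norm.mul_left w
  have hkey : ∑' m, (z * (linCoeff l (m + 1) * z ^ (m + 1)) -
      w * (linCoeff l (m + 1) * w ^ (m + 1))) = w - z := by
    simp only at hzw
    rw [← tsum_mul_left, ← tsum_mul_left, ← sub_eq_zero, ← hsz.tsum_sub hsw,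
      (hsz.sub hsw).tsum_eq_zero_add, linCoeff_zero] at hzw
    linear_combination hzw
  have hgeom : HasSum (fun m : ℕ => ‖z - w‖ / 4 * (1 / 4 : ℝ) ^ m)
      (‖z - w‖ / 4 * (1 - 1 / 4)⁻¹) :=
    (hasSum_geometric_of_lt_one (by norm_num) (by norm_num)).mul_left _
  have hbound := tsum_of_norm_bounded hgeom (f := fun m => z * (linCoeff l (m + 1) * z ^ (m + 1)) -
      w * (linCoeff l (m + 1) * w ^ (m + 1))) fun m => by
    have h2 : ((m : ℝ) + 1 + 1) ≤ 2 ^ (m + 1) := by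
      exact_mod_cast Nat.succ_le_of_lt (Nat.lt_two_pow_self (n := m + 1))
    have h1 := norm_pow_succ_sub_pow_succ_le hz hw (m + 1)
    calc _ = ‖linCoeff l (m + 1)‖ * ‖z ^ (m + 1 + 1) - w ^ (m + 1 + 1)‖ := by
          rw [← norm_mul]
          ring_nf
      _ ≤ M ^ (m + 1) * (2 ^ (m + 1) * (1 / (8 * M)) ^ (m + 1) * ‖z - w‖) := by
          refine mul_le_mul (hc _) (h1.trans ?_) (norm_nonneg _) (by positivity)
          push_cast
          gcongr
      _ = (M * 2 * (1 / (8 * M))) ^ (m + 1) * ‖z - w‖ := by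
          rw [mul_pow, mul_pow]
          ring
      _ = ‖z - w‖ / 4 * (1 / 4 : ℝ) ^ m := by
          rw [show M * 2 * (1 / (8 * M)) = 1 / 4 by field_simp; norm_num, pow_succ]
          ring
  rw [hkey, norm_sub_rev] at hbound
  have h0 : ‖z - w‖ = 0 := by
    norm_num at hbound
    linarith [norm_nonneg (z - w)]
  exact sub_eq_zero.1 (norm_eq_zero.1 h0)

end Linearization

/-- Linearizations of `P_θ` are bounded by `2`, so by Cauchy's estimate their domains have bounded
size. -/
lemma radius_le_two {θ ρ : ℝ} {φ : ℂ → ℂ}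
    (hd : DifferentiableOn ℂ φ (Metric.ball (0 : ℂ) ρ)) (hφ' : deriv φ 0 = 1)
    (hφ : ∀ z ∈ Metric.ball (0 : ℂ) ρ,
      Ptheta θ (φ z) = φ (Complex.exp (2 * Real.pi * Complex.I * θ) * z)) : ρ ≤ 2 := by
  refine le_of_forall_lt_imp_le_of_dense fun r hr => ?_
  rcases le_or_gt r 0 with hr0 | hr0
  · linarith
  have hsub : Metric.closedBall (0 : ℂ) r ⊆ Metric.ball 0 ρ := Metric.closedBall_subset_ball hr
  have hl1 := norm_exp_two_pi_I_mul θ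
  set l := Complex.exp (2 * Real.pi * Complex.I * θ) with hl
  obtain ⟨x, hx, hmax⟩ := (isCompact_closedBall (0 : ℂ) r).exists_isMaxOn
    (Metric.nonempty_closedBall.2 hr0.le) (hd.continuousOn.mono hsub).norm
  have hlx : l * x ∈ Metric.closedBall (0 : ℂ) r := by
    rw [mem_closedBall_zero_iff] at hx ⊢
    rwa [norm_mul, hl1, one_mul]
  have h1 : ‖φ x‖ * (‖φ x‖ - 1) ≤ ‖φ x‖ := by
    have h2 : ‖φ (l * x)‖ ≤ ‖φ x‖ := hmax hlx
    rw [← hφ x (hsub hx), Ptheta, ← hl, show φ x ^ 2 + l * φ x = φ x * (φ x + l) by ring,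
      norm_mul] at h2
    refine le_trans (mul_le_mul_of_nonneg_left ?_ (norm_nonneg _)) h2
    have := norm_sub_le (φ x + l) l
    rw [add_sub_cancel_right, hl1] at this
    linarith
  have h2 : ‖φ x‖ ≤ 2 := by
    by_contra h
    nlinarith
  have hcont : DiffContOnCl ℂ φ (Metric.ball 0 r) := by
    refine DifferentiableOn.diffContOnCl ?_
    rw [closure_ball _ hr0.ne']
    exact hd.mono hsub
  have h3 := Complex.norm_deriv_le_of_forall_mem_sphere_norm_le hr0 hcont (C := 2) fun z hz =>
    (hmax (Metric.sphere_subset_closedBall hz)).trans h2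
  rw [hφ', norm_one, le_div_iff₀ hr0, one_mul] at h3
  exact h3

lemma le_siegelRadius {θ ρ : ℝ} (hρ : 0 < ρ) {φ : ℂ → ℂ}
    (hinj : Set.InjOn φ (Metric.ball (0 : ℂ) ρ))
    (hd : DifferentiableOn ℂ φ (Metric.ball (0 : ℂ) ρ)) (hφ0 : φ 0 = 0) (hφ' : deriv φ 0 = 1)
    (hφ : ∀ z ∈ Metric.ball (0 : ℂ) ρ,
      Ptheta θ (φ z) = φ (Complex.exp (2 * Real.pi * Complex.I * θ) * z)) : ρ ≤ siegelRadius θ := by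
  refine le_csSup ⟨2, ?_⟩ ⟨hρ, φ, hinj, hd, hφ0, hφ', hφ⟩
  rintro r ⟨-, ψ, -, hψ, -, hψ', hψe⟩
  exact radius_le_two hψ hψ' hψe

lemma siegelRadius_ge {θ : ℝ} (hθ : θ ∈ Set.Ioo (0 : ℝ) 1) (hirr : Irrational θ)
    (hs : Summable (brjunoTerm θ)) :
    1 / (8 * (4 * Real.exp (brjunoFunction θ + 44))) ≤ siegelRadius θ := by
  have hc := norm_linCoeff_le hθ hirr hs
  have hl1 := norm_exp_two_pi_I_mul θ
  have hM : 0 < 4 * Real.exp (brjunoFunction θ + 44) := by positivity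
  set M := 4 * Real.exp (brjunoFunction θ + 44)
  set l := Complex.exp (2 * π * Complex.I * θ) with hl
  have hl0 (m : ℕ) : l ^ (m + 2) - l ≠ 0 := by
    have hpos := (mul_pos four_pos (abs_sub_round_pos hirr (m := m + 1) (by lia))).trans_le
      (four_mul_abs_sub_round_le_norm_pow (m + 1))
    rw [show l ^ (m + 2) - l = l * (l ^ (m + 1) - 1) by ring]
    exact mul_ne_zero (Complex.exp_ne_zero _) (norm_pos_iff.1 hpos)
  have hρ : 0 < 1 / (8 * M) := by positivity
  have hd := differentiableOn_linCoeff_tsum hM hc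
  refine le_siegelRadius hρ (injOn_linearization hM hc) (differentiableOn_id.mul hd) (by simp) ?_
    fun z hz => ?_
  · have h0 := (hd.differentiableAt (Metric.ball_mem_nhds 0 hρ)).hasDerivAt
    have h := ((hasDerivAt_id (0 : ℂ)).mul h0).deriv
    have hu : ∑' m, linCoeff l m * (0 : ℂ) ^ m = 1 := by
      rw [tsum_eq_single 0 fun m hm => by simp [hm]]
      simp [linCoeff_zero]
    simpa [hu] using! h
  · exact linearization_equation hl1 hl0 hM hc (mem_ball_zero_iff.1 hz).le

/-- Yoccoz's lower bound: `Φ(θ) + log r(θ)` is bounded below uniformly over all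
irrational Brjuno numbers `θ ∈ (0,1)`. -/
theorem yoccoz_lower_bound :
    ∃ C : ℝ, ∀ θ ∈ Set.Ioo (0 : ℝ) 1, Irrational θ → Summable (brjunoTerm θ) →
      0 < siegelRadius θ ∧
      C ≤ brjunoFunction θ + Real.log (siegelRadius θ) := by
  refine ⟨-Real.log 32 - 44, fun θ hθ hirr hs => ?_⟩
  have h := siegelRadius_ge hθ hirr hs
  have hpos : 0 < 1 / (8 * (4 * Real.exp (brjunoFunction θ + 44))) := by positivity
  refine ⟨hpos.trans_le h, ?_⟩
  have hlog := Real.log_le_log hpos h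
  rw [← mul_assoc, one_div, Real.log_inv, Real.log_mul (by norm_num) (Real.exp_ne_zero _),
    Real.log_exp] at hlog
  norm_num at hlog
  linarith
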